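/- arXiv:0707.3545 — 2 statements merged into one kernel-verified Lean document; each statement's English description precedes it below -/
import Mathlib

section
/- Let F be a distribution function on ℝ with F(x) = 0 for every x ≤ 0, and set p_k := ∫_0^∞ (t^k/k!) e^{−t} dF(t) for integers k ≥ 0. Then for every γ > 0, the series Σ_{k≥0} k^γ p_k is finite if and only if ∫_0^∞ t^γ dF(t) is finite; i.e. a mixed Poisson distribution has a finite moment of order γ exactly when its mixing distribution does. -/
open MeasureTheory Filter Topology

/-- The probability that a Poisson variable with mean `t` takes the value `k`. -/
noncomputable def poissonWeight (t : ℝ) (k : ℕ) : ℝ := t ^ k * Real.exp (-t) / (k.factorial : ℝ)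

lemma poissonWeight_nonneg {t : ℝ} (ht : 0 ≤ t) (k : ℕ) : 0 ≤ poissonWeight t k := by
  unfold poissonWeight; positivity

lemma continuous_poissonWeight (k : ℕ) : Continuous fun t => poissonWeight t k := by
  unfold poissonWeight; fun_prop

lemma hasSum_exp_mul_poissonWeight (s t : ℝ) :
    HasSum (fun k : ℕ => Real.exp (s * k) * poissonWeight t k)
      (Real.exp ((Real.exp s - 1) * t)) := by
  have h := (NormedSpace.expSeries_div_hasSum_exp (Real.exp s * t)).mul_right (Real.exp (-t))
  rw [← Real.exp_eq_exp_ℝ, ← Real.exp_add] at h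
  have hexp : (Real.exp s - 1) * t = Real.exp s * t + -t := by ring
  rw [hexp]
  refine (funext fun k => ?_ : (fun k : ℕ => Real.exp (s * k) * poissonWeight t k) = _) ▸ h
  rw [mul_comm s, Real.exp_nat_mul, poissonWeight, mul_pow]
  ring

lemma hasSum_poissonWeight (t : ℝ) : HasSum (poissonWeight t) 1 := by
  simpa using hasSum_exp_mul_poissonWeight 0 t

lemma poissonWeight_le_one {t : ℝ} (ht : 0 ≤ t) (k : ℕ) : poissonWeight t k ≤ 1 :=
  le_hasSum (hasSum_poissonWeight t) k fun j _ => poissonWeight_nonneg ht j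

lemma rpow_le_mul_exp {γ b x : ℝ} (hγ : 0 < γ) (hb : 0 < b) (hx : 0 ≤ x) :
    x ^ γ ≤ (γ / b) ^ γ * Real.exp (b * x) := by
  have h : x ≤ γ / b * Real.exp (b * x / γ) := by
    have h1 := Real.add_one_le_exp (b * x / γ)
    calc x = γ / b * (b * x / γ) := by field_simp
      _ ≤ _ := by gcongr; linarith
  calc x ^ γ ≤ (γ / b * Real.exp (b * x / γ)) ^ γ := Real.rpow_le_rpow hx h hγ.le
    _ = _ := by
      rw [Real.mul_rpow (by positivity) (Real.exp_pos _).le, ← Real.exp_mul]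
      congr 2; field_simp

lemma natCast_rpow_le {γ t : ℝ} (hγ : 0 < γ) (ht : 0 ≤ t) (k : ℕ) :
    (k : ℝ) ^ γ ≤ (Real.exp 2 * t) ^ γ
      + γ ^ γ * Real.exp (-(Real.exp 2 * t)) * Real.exp (2 * k) := by
  rcases le_total (k : ℝ) (Real.exp 2 * t) with h | h
  · have := Real.rpow_le_rpow k.cast_nonneg h hγ.le
    have : 0 ≤ γ ^ γ * Real.exp (-(Real.exp 2 * t)) * Real.exp (2 * k) := by positivity
    linarith
  · have h1 := rpow_le_mul_exp hγ one_pos (k.cast_nonneg (α := ℝ))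
    have h2 : γ ^ γ * Real.exp k ≤
        γ ^ γ * Real.exp (-(Real.exp 2 * t)) * Real.exp (2 * k) := by
      rw [mul_assoc, ← Real.exp_add]
      gcongr
      linarith
    have : 0 ≤ (Real.exp 2 * t) ^ γ := by positivity
    simp only [div_one, one_mul] at h1
    linarith

lemma rpow_le_natCast_rpow_add {γ t : ℝ} (hγ : 0 < γ) (ht : 0 ≤ t) (k : ℕ) :
    t ^ γ ≤ 2 ^ γ * (k : ℝ) ^ γ + t ^ γ * Real.exp (t / 2) * Real.exp (-1 * k) := by
  rcases le_total t (2 * k) with h | h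
  · have h1 := Real.rpow_le_rpow ht h hγ.le
    rw [Real.mul_rpow two_pos.le k.cast_nonneg] at h1
    have : 0 ≤ t ^ γ * Real.exp (t / 2) * Real.exp (-1 * k) := by positivity
    linarith
  · have h1 : t ^ γ * 1 ≤ t ^ γ * Real.exp (t / 2 + -1 * k) := by
      gcongr
      exact Real.one_le_exp (by linarith)
    rw [Real.exp_add, ← mul_assoc] at h1
    have : (0 : ℝ) ≤ 2 ^ γ * (k : ℝ) ^ γ := by positivity
    linarith

lemma summable_rpow_mul_poissonWeight {γ t : ℝ} (hγ : 0 < γ) (ht : 0 ≤ t) :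
    Summable fun k : ℕ => (k : ℝ) ^ γ * poissonWeight t k := by
  refine Summable.of_nonneg_of_le
    (fun k => mul_nonneg (by positivity) (poissonWeight_nonneg ht k)) (fun k => ?_)
    ((hasSum_exp_mul_poissonWeight 1 t).summable.mul_left (γ ^ γ))
  rw [← mul_assoc]
  have h := rpow_le_mul_exp hγ one_pos (k.cast_nonneg (α := ℝ))
  rw [div_one] at h
  exact mul_le_mul_of_nonneg_right h (poissonWeight_nonneg ht k)

/-- The moment of order `γ` of the Poisson distribution with mean `t`. -/
noncomputable def poissonMoment (γ t : ℝ) : ℝ := ∑' k : ℕ, (k : ℝ) ^ γ * poissonWeight t k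

lemma poissonMoment_nonneg (γ : ℝ) {t : ℝ} (ht : 0 ≤ t) : 0 ≤ poissonMoment γ t :=
  tsum_nonneg fun k => mul_nonneg (by positivity) (poissonWeight_nonneg ht k)

lemma poissonMoment_le {γ t : ℝ} (hγ : 0 < γ) (ht : 0 ≤ t) :
    poissonMoment γ t ≤ Real.exp 2 ^ γ * t ^ γ + γ ^ γ := by
  have h := ((hasSum_poissonWeight t).mul_left ((Real.exp 2 * t) ^ γ)).add
    ((hasSum_exp_mul_poissonWeight 2 t).mul_left (γ ^ γ * Real.exp (-(Real.exp 2 * t))))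
  have h1 := hasSum_le (fun k => ?_) (summable_rpow_mul_poissonWeight hγ ht).hasSum h
  · rw [mul_assoc (γ ^ γ), ← Real.exp_add, Real.mul_rpow (Real.exp_pos _).le ht, mul_one] at h1
    refine h1.trans ?_
    gcongr
    refine mul_le_of_le_one_right (by positivity) (Real.exp_le_one_iff.2 ?_)
    linarith
  · rw [← mul_assoc, ← add_mul]
    exact mul_le_mul_of_nonneg_right (natCast_rpow_le hγ ht k) (poissonWeight_nonneg ht k)

lemma rpow_le_poissonMoment {γ t : ℝ} (hγ : 0 < γ) (ht : 0 ≤ t) :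
    t ^ γ ≤ 2 ^ γ * poissonMoment γ t + (γ / (1 / 2 - Real.exp (-1))) ^ γ := by
  have hb : 0 < 1 / 2 - Real.exp (-1) := by
    have := Real.exp_neg_one_lt_half
    linarith
  have h := ((summable_rpow_mul_poissonWeight hγ ht).hasSum.mul_left (2 ^ γ)).add
    ((hasSum_exp_mul_poissonWeight (-1) t).mul_left (t ^ γ * Real.exp (t / 2)))
  have h1 := hasSum_le (fun k => ?_) ((hasSum_poissonWeight t).mul_left (t ^ γ)) h
  · rw [mul_one, mul_assoc (t ^ γ), ← Real.exp_add] at h1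
    refine h1.trans ?_
    unfold poissonMoment
    gcongr
    calc t ^ γ * Real.exp (t / 2 + (Real.exp (-1) - 1) * t)
        ≤ (γ / (1 / 2 - Real.exp (-1))) ^ γ * Real.exp ((1 / 2 - Real.exp (-1)) * t)
          * Real.exp (t / 2 + (Real.exp (-1) - 1) * t) := by
          gcongr
          exact rpow_le_mul_exp hγ hb ht
      _ = _ := by
          rw [mul_assoc, ← Real.exp_add]
          ring_nf
          simp
  · rw [← mul_assoc, ← mul_assoc, ← add_mul]
    exact mul_le_mul_of_nonneg_right (rpow_le_natCast_rpow_add hγ ht k)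
      (poissonWeight_nonneg ht k)

lemma measurable_poissonMoment (γ : ℝ) : Measurable (poissonMoment γ) := by
  unfold poissonMoment
  exact Measurable.tsum fun k => ((continuous_poissonWeight k).measurable).const_mul _

lemma summable_iff_integrable_poissonMoment {μ : Measure ℝ} [IsProbabilityMeasure μ]
    (hμ : ∀ᵐ t ∂μ, 0 ≤ t) {γ : ℝ} (hγ : 0 < γ) :
    Summable (fun k : ℕ => (k : ℝ) ^ γ * ∫ t, poissonWeight t k ∂μ) ↔
      Integrable (poissonMoment γ) μ := by
  have hintegrable (k : ℕ) : Integrable (fun t => (k : ℝ) ^ γ * poissonWeight t k) μ := by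
    refine (Integrable.of_bound (continuous_poissonWeight k).aestronglyMeasurable 1 ?_).const_mul _
    filter_upwards [hμ] with t ht
    rw [Real.norm_of_nonneg (poissonWeight_nonneg ht k)]
    exact poissonWeight_le_one ht k
  have hnn (k : ℕ) : 0 ≤ᵐ[μ] fun t => (k : ℝ) ^ γ * poissonWeight t k := by
    filter_upwards [hμ] with t ht
    exact mul_nonneg (by positivity) (poissonWeight_nonneg ht k)
  have hM : 0 ≤ᵐ[μ] poissonMoment γ := by
    filter_upwards [hμ] with t ht
    exact poissonMoment_nonneg γ ht
  have key : ∑' k : ℕ, ENNReal.ofReal (∫ t, (k : ℝ) ^ γ * poissonWeight t k ∂μ)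
      = ∫⁻ t, ENNReal.ofReal (poissonMoment γ t) ∂μ := by
    simp_rw [fun k => ofReal_integral_eq_lintegral_ofReal (hintegrable k) (hnn k)]
    rw [← lintegral_tsum fun k => (hintegrable k).aestronglyMeasurable.aemeasurable.ennreal_ofReal]
    refine lintegral_congr_ae ?_
    filter_upwards [hμ] with t ht
    exact (ENNReal.ofReal_tsum_of_nonneg
      (fun k => mul_nonneg (by positivity) (poissonWeight_nonneg ht k))
      (summable_rpow_mul_poissonWeight hγ ht)).symm
  simp_rw [← integral_const_mul]
  rw [← lintegral_ofReal_ne_top_iff_integrable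
    (measurable_poissonMoment γ).aestronglyMeasurable hM, ← key]
  refine ⟨fun h => h.tsum_ofReal_ne_top, fun h => ?_⟩
  refine (ENNReal.summable_toReal h).congr fun k => ?_
  exact ENNReal.toReal_ofReal (integral_nonneg_of_ae (hnn k))

/-- A mixed Poisson distribution has a finite moment of order `γ`
exactly when its mixing distribution does. -/
theorem mixed_poisson_moment_iff
    (μ : Measure ℝ) (hμprob : IsProbabilityMeasure μ)
    (hsupp : μ (Set.Iio (0 : ℝ)) = 0)
    (p : ℕ → ℝ)
    (hp : ∀ k : ℕ, p k = ∫ t, t ^ k * Real.exp (-t) / (k.factorial : ℝ) ∂μ)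
    (γ : ℝ) (hγ : 0 < γ) :
    Summable (fun k : ℕ => (k : ℝ) ^ γ * p k) ↔
      Integrable (fun t : ℝ => t ^ γ) μ := by
  have hμ : ∀ᵐ t ∂μ, 0 ≤ t := by
    rw [ae_iff]
    simp only [not_le]
    exact hsupp
  have h := summable_iff_integrable_poissonMoment hμ hγ
  simp only [poissonWeight, ← hp] at h
  rw [h]
  constructor <;> intro hi
  · refine ((hi.const_mul (2 ^ γ)).add
      (integrable_const ((γ / (1 / 2 - Real.exp (-1))) ^ γ))).mono'
      (measurable_id.pow_const γ).aestronglyMeasurable ?_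
    filter_upwards [hμ] with t ht
    rw [Real.norm_of_nonneg (by positivity)]
    exact rpow_le_poissonMoment hγ ht
  · refine ((hi.const_mul (Real.exp 2 ^ γ)).add (integrable_const (γ ^ γ))).mono'
      (measurable_poissonMoment γ).aestronglyMeasurable ?_
    filter_upwards [hμ] with t ht
    rw [Real.norm_of_nonneg (poissonMoment_nonneg γ ht)]
    exact poissonMoment_le hγ ht
end

section
/- Let γ > β > 2 and A > 0, and for u > 0, β' > 1 let p_{u,β'}(k) := (u^{β'−1}(β'−1)/k!) ∫_u^∞ t^{k−β'} e^{−t} dt. Then for every integer k ≥ 0, ((β−1)(γ−1)A^{γ−1}/k!) ∫_A^∞ ∫_α^∞ α^{β−γ−1} t^{k−β} e^{−t} dt dα = ((γ−1)/(γ−β)) p_{A,β}(k) − ((β−1)/(γ−β)) p_{A,γ}(k); in particular this sequence of probabilities behaves like ((γ−1)/(γ−β)) A^{β−1}(β−1) k^{−β}(1+o(1)) as k → ∞. -/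
open MeasureTheory Filter Topology

theorem continuousOn_rpow_mul_exp_neg (s : ℝ) :
    ContinuousOn (fun t : ℝ => t ^ s * Real.exp (-t)) (Set.Ioi 0) :=
  (continuousOn_id.rpow_const fun x hx => Or.inl (ne_of_gt hx)).mul
    (by fun_prop : Continuous fun t : ℝ => Real.exp (-t)).continuousOn

theorem integrableOn_Ioi_rpow_mul_exp_neg {a : ℝ} (ha : 0 < a) (s : ℝ) :
    IntegrableOn (fun t : ℝ => t ^ s * Real.exp (-t)) (Set.Ioi a) := by
  refine integrable_of_isBigO_exp_neg one_half_pos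
    ((continuousOn_rpow_mul_exp_neg s).mono fun x hx => lt_of_lt_of_le ha hx) ?_
  simpa only [mul_comm] using (Real.Gamma_integrand_isLittleO s).isBigO

/-- The derivative of a tail integral with respect to its lower limit. -/
theorem hasDerivAt_integral_Ioi {f : ℝ → ℝ} {c a : ℝ} (hca : c < a)
    (hf : ContinuousOn f (Set.Ioi c)) (hint : IntegrableOn f (Set.Ioi c)) :
    HasDerivAt (fun x => ∫ t in Set.Ioi x, f t) (-f a) a := by
  have hFTC : HasDerivAt (fun x => ∫ t in c..x, f t) (f a) a :=
    intervalIntegral.integral_hasDerivAt_right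
      ((intervalIntegrable_iff_integrableOn_Ioc_of_le hca.le).2
        (hint.mono_set Set.Ioc_subset_Ioi_self))
      (hf.stronglyMeasurableAtFilter isOpen_Ioi a hca)
      (hf.continuousAt (Ioi_mem_nhds hca))
  refine (hFTC.const_sub (∫ t in Set.Ioi c, f t)).congr_of_eventuallyEq ?_
  filter_upwards [Ioi_mem_nhds hca] with x hx
  rw [← intervalIntegral.integral_Ioi_sub_Ioi hint (le_of_lt hx), sub_sub_cancel]

/-- Exchanging the order of integration in an iterated upper incomplete Gamma integral. -/
theorem integral_Ioi_rpow_mul_integral_Ioi {A δ : ℝ} (hA : 0 < A) (hδ : δ < 0) (s : ℝ) :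
    ∫ a in Set.Ioi A, ∫ t in Set.Ioi a, a ^ (δ - 1) * t ^ s * Real.exp (-t) =
      (A ^ δ * (∫ t in Set.Ioi A, t ^ s * Real.exp (-t)) -
        ∫ t in Set.Ioi A, t ^ (s + δ) * Real.exp (-t)) / (-δ) := by
  set F : ℝ → ℝ → ℝ := fun r x => ∫ t in Set.Ioi x, t ^ r * Real.exp (-t)
  have hF : ∀ r a : ℝ, 0 < a → HasDerivAt (F r) (-(a ^ r * Real.exp (-a))) a := fun r a ha =>
    hasDerivAt_integral_Ioi (half_lt_self ha)
      ((continuousOn_rpow_mul_exp_neg r).mono (Set.Ioi_subset_Ioi (half_pos ha).le))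
      (integrableOn_Ioi_rpow_mul_exp_neg (half_pos ha) r)
  have hderiv : ∀ a ∈ Set.Ici A,
      HasDerivAt (fun x => (x ^ δ * F s x - F (s + δ) x) / δ) (a ^ (δ - 1) * F s a) a := by
    intro a ha
    have ha0 : 0 < a := hA.trans_le ha
    convert! ((((Real.hasDerivAt_rpow_const (Or.inl ha0.ne')).mul (hF s a ha0)).sub
      (hF (s + δ) a ha0)).div_const δ) using 1
    rw [Real.rpow_add ha0]
    field_simp [hδ.ne]
    ring
  have hnonneg : ∀ a ∈ Set.Ioi A, 0 ≤ a ^ (δ - 1) * F s a := by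
    intro a ha
    have ha0 : 0 < a := hA.trans ha
    refine mul_nonneg (Real.rpow_nonneg ha0.le _) (setIntegral_nonneg measurableSet_Ioi ?_)
    intro t ht
    have : 0 < t := ha0.trans ht
    positivity
  have hlim : Tendsto (fun x => (x ^ δ * F s x - F (s + δ) x) / δ) atTop (𝓝 0) := by
    have h0 : ∀ r, Tendsto (F r) atTop (𝓝 0) := fun r => tendsto_integral_Ioi_zero tendsto_id
    have hpow : Tendsto (fun x : ℝ => x ^ δ) atTop (𝓝 0) := by
      simpa using tendsto_rpow_neg_atTop (neg_pos.2 hδ)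
    simpa using ((hpow.mul (h0 s)).sub (h0 (s + δ))).div_const δ
  have hint := integral_Ioi_of_hasDerivAt_of_nonneg' hderiv hnonneg hlim
  simp_rw [mul_assoc, integral_const_mul]
  rw [hint, zero_sub, div_neg]

theorem Gamma_add_natCast_eq_mul_prod {s : ℝ} (hs : 0 < s) (n : ℕ) :
    Real.Gamma (s + n) = Real.Gamma s * ∏ j ∈ Finset.range n, (s + j) := by
  induction n with
  | zero => simp
  | succ n ih =>
    rw [Finset.prod_range_succ, Nat.cast_succ, ← add_assoc, Real.Gamma_add_one (by positivity), ih]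
    ring

/-- For positive `x`, `Γ(n + 1 + x) ∼ n ! n ^ x`. -/
theorem tendsto_Gamma_div_factorial_mul_rpow_of_pos {x : ℝ} (hx : 0 < x) :
    Tendsto (fun n : ℕ => Real.Gamma (n + 1 + x) / (n.factorial * (n : ℝ) ^ x)) atTop (𝓝 1) := by
  have hG : Real.Gamma x ≠ 0 := (Real.Gamma_pos_of_pos hx).ne'
  have h := (Real.GammaSeq_tendsto_Gamma x).inv₀ hG |>.const_mul (Real.Gamma x)
  rw [mul_inv_cancel₀ hG] at h
  refine h.congr fun n => ?_
  have := Gamma_add_natCast_eq_mul_prod hx (n + 1)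
  rw [show (n : ℝ) + 1 + x = x + (n + 1 : ℕ) by push_cast; ring, this, Real.GammaSeq, inv_div,
    mul_div_assoc, mul_comm ((n : ℝ) ^ x)]

/-- For every real `x`, `Γ(n + 1 + x) ∼ n ! n ^ x`. -/
theorem tendsto_Gamma_div_factorial_mul_rpow (x : ℝ) :
    Tendsto (fun n : ℕ => Real.Gamma (n + 1 + x) / (n.factorial * (n : ℝ) ^ x)) atTop (𝓝 1) := by
  suffices H : ∀ (m : ℕ) (x : ℝ), 0 < x + m → Tendsto (fun n : ℕ =>
      Real.Gamma (n + 1 + x) / (n.factorial * (n : ℝ) ^ x)) atTop (𝓝 1) by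
    obtain ⟨m, hm⟩ := exists_nat_gt (-x)
    exact H m x (by linarith)
  intro m
  induction m with
  | zero => exact fun x hx => tendsto_Gamma_div_factorial_mul_rpow_of_pos (by simpa using hx)
  | succ m ih =>
    intro x hx
    push_cast at hx
    have h := (ih (x + 1) (by linarith)).mul (tendsto_natCast_div_add_atTop (𝕜 := ℝ) (x + 1))
    rw [one_mul] at h
    refine h.congr' ?_
    filter_upwards [eventually_gt_atTop 0,
      tendsto_natCast_atTop_atTop.eventually_gt_atTop (-(x + 1))] with n hn hnx
    have hn' : (0 : ℝ) < n := by exact_mod_cast hn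
    have hpos : (0 : ℝ) < n + (x + 1) := by linarith
    rw [show (n : ℝ) + 1 + (x + 1) = (n + (x + 1)) + 1 by ring, Real.Gamma_add_one hpos.ne',
      show (n : ℝ) + 1 + x = n + (x + 1) by ring, Real.rpow_add_one hn'.ne']
    have := Real.rpow_pos_of_pos hn' x
    field_simp

theorem tendsto_rpow_mul_pow_div_factorial (b c : ℝ) :
    Tendsto (fun k : ℕ => (k : ℝ) ^ b * (c ^ k / k.factorial)) atTop (𝓝 0) := by
  have h1 := (isLittleO_rpow_exp_atTop b).tendsto_div_nhds_zero.comp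
    (tendsto_natCast_atTop_atTop (R := ℝ))
  have h2 := FloorSemiring.tendsto_pow_div_factorial_atTop (Real.exp 1 * c)
  have h := h1.mul h2
  rw [zero_mul] at h
  refine h.congr fun k => ?_
  have : Real.exp (k : ℝ) = Real.exp 1 ^ k := by rw [← Real.exp_nat_mul, mul_one]
  simp only [Function.comp_apply]
  rw [mul_pow, this]
  field_simp

/-- The part of the Gamma integral below a fixed threshold is negligible. -/
theorem tendsto_rpow_div_factorial_mul_integral_Ioc {A : ℝ} (hA : 0 < A) (b : ℝ) :
    Tendsto (fun k : ℕ => (k : ℝ) ^ b / k.factorial *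
      ∫ t in Set.Ioc 0 A, t ^ ((k : ℝ) - b) * Real.exp (-t)) atTop (𝓝 0) := by
  have h := (tendsto_rpow_mul_pow_div_factorial b A).mul_const (A ^ (-b) * A)
  rw [zero_mul] at h
  refine squeeze_zero' (Eventually.of_forall fun k => ?_) ?_ h
  · refine mul_nonneg (by positivity) (setIntegral_nonneg measurableSet_Ioc fun t ht => ?_)
    exact mul_nonneg (Real.rpow_nonneg ht.1.le _) (Real.exp_pos _).le
  · filter_upwards [(tendsto_natCast_atTop_atTop (R := ℝ)).eventually_ge_atTop b] with k hk
    have hbound : ∫ t in Set.Ioc 0 A, t ^ ((k : ℝ) - b) * Real.exp (-t) ≤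
        A ^ ((k : ℝ) - b) * A := by
      have hle : ∀ t ∈ Set.Ioc 0 A, ‖t ^ ((k : ℝ) - b) * Real.exp (-t)‖ ≤ A ^ ((k : ℝ) - b) := by
        intro t ht
        rw [Real.norm_of_nonneg (mul_nonneg (Real.rpow_nonneg ht.1.le _) (Real.exp_pos _).le)]
        exact (mul_le_of_le_one_right (Real.rpow_nonneg ht.1.le _)
          (Real.exp_le_one_iff.2 (neg_nonpos.2 ht.1.le))).trans
          (Real.rpow_le_rpow ht.1.le ht.2 (sub_nonneg.2 hk))
      have := norm_setIntegral_le_of_norm_le_const (μ := volume) (by simp) hle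
      rw [Real.volume_real_Ioc_of_le hA.le, sub_zero] at this
      exact (Real.le_norm_self _).trans this
    calc _ ≤ (k : ℝ) ^ b / k.factorial * (A ^ ((k : ℝ) - b) * A) := by gcongr
      _ = _ := by
        rw [sub_eq_add_neg, Real.rpow_add hA, Real.rpow_natCast]
        ring

/-- The upper incomplete Gamma integral satisfies `Γ(k + 1 - b, A) ∼ k ! k ^ (-b)`. -/
theorem tendsto_rpow_div_factorial_mul_integral_Ioi {A : ℝ} (hA : 0 < A) (b : ℝ) :
    Tendsto (fun k : ℕ => (k : ℝ) ^ b / k.factorial *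
      ∫ t in Set.Ioi A, t ^ ((k : ℝ) - b) * Real.exp (-t)) atTop (𝓝 1) := by
  have h := (tendsto_Gamma_div_factorial_mul_rpow (-b)).sub
    (tendsto_rpow_div_factorial_mul_integral_Ioc hA b)
  rw [sub_zero] at h
  refine h.congr' ?_
  filter_upwards [(tendsto_natCast_atTop_atTop (R := ℝ)).eventually_ge_atTop b] with k hk
  have hs : 0 < (k : ℝ) + 1 + -b := by linarith
  have hfun : (fun t : ℝ => Real.exp (-t) * t ^ ((k : ℝ) + 1 + -b - 1)) =
      fun t => t ^ ((k : ℝ) - b) * Real.exp (-t) := by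
    ext t
    rw [mul_comm, show (k : ℝ) + 1 + -b - 1 = k - b by ring]
  have hint := Real.GammaIntegral_convergent hs
  rw [hfun] at hint
  have hsplit : Real.Gamma ((k : ℝ) + 1 + -b) =
      (∫ t in Set.Ioc 0 A, t ^ ((k : ℝ) - b) * Real.exp (-t)) +
        ∫ t in Set.Ioi A, t ^ ((k : ℝ) - b) * Real.exp (-t) := by
    rw [Real.Gamma_eq_integral hs, hfun, ← Set.Ioc_union_Ioi_eq_Ioi hA.le,
      setIntegral_union (Set.Ioc_disjoint_Ioi le_rfl) measurableSet_Ioi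
        (hint.mono_set Set.Ioc_subset_Ioi_self) (hint.mono_set (Set.Ioi_subset_Ioi hA.le))]
  rw [hsplit, Real.rpow_neg k.cast_nonneg, ← div_eq_mul_inv, div_div_eq_mul_div]
  ring

/-- The limit out-degree distribution of the hierarchical model is a
mixture of two Pareto-mixed Poisson laws, and has a power-law tail of exponent `β`. -/
theorem hierarchical_limit_distribution
    (γ β A : ℝ) (hβ : 2 < β) (hγ : β < γ) (hA : 0 < A)
    (p : ℝ → ℝ → ℕ → ℝ)
    (hp : ∀ u β' : ℝ, ∀ k : ℕ, p u β' k = u ^ (β' - 1) * (β' - 1) / (k.factorial : ℝ) *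
      ∫ t in Set.Ioi u, t ^ ((k : ℝ) - β') * Real.exp (-t))
    (q : ℕ → ℝ)
    (hq : ∀ k : ℕ, q k = ((β - 1) * (γ - 1) * A ^ (γ - 1) / (k.factorial : ℝ)) *
      ∫ a in Set.Ioi A, ∫ t in Set.Ioi a,
        a ^ (β - γ - 1) * t ^ ((k : ℝ) - β) * Real.exp (-t)) :
    (∀ k : ℕ, q k = (γ - 1) / (γ - β) * p A β k - (β - 1) / (γ - β) * p A γ k) ∧
    Tendsto (fun k : ℕ => (k : ℝ) ^ β * q k) atTop
      (𝓝 ((γ - 1) / (γ - β) * A ^ (β - 1) * (β - 1))) := by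
  have hmix : ∀ k : ℕ,
      q k = (γ - 1) / (γ - β) * p A β k - (β - 1) / (γ - β) * p A γ k := by
    intro k
    rw [hq, hp, hp, integral_Ioi_rpow_mul_integral_Ioi hA (sub_neg.2 hγ),
      show (k : ℝ) - β + (β - γ) = k - γ by ring, neg_sub,
      show A ^ (β - 1) = A ^ (γ - 1) * A ^ (β - γ) by rw [← Real.rpow_add hA]; ring_nf]
    ring
  refine ⟨hmix, ?_⟩
  have hdecay : Tendsto (fun k : ℕ => (k : ℝ) ^ (β - γ)) atTop (𝓝 0) := by
    simpa [Function.comp_def] using (tendsto_rpow_neg_atTop (sub_pos.2 hγ)).comp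
      (tendsto_natCast_atTop_atTop (R := ℝ))
  have h := ((tendsto_rpow_div_factorial_mul_integral_Ioi hA β).const_mul
      ((γ - 1) / (γ - β) * A ^ (β - 1) * (β - 1))).sub
    ((hdecay.mul (tendsto_rpow_div_factorial_mul_integral_Ioi hA γ)).const_mul
      ((β - 1) / (γ - β) * A ^ (γ - 1) * (γ - 1)))
  rw [zero_mul, mul_zero, sub_zero, mul_one] at h
  refine h.congr' ?_
  filter_upwards [eventually_gt_atTop 0] with k hk
  have hk' : (0 : ℝ) < k := by exact_mod_cast hk
  rw [hmix, hp, hp, show (k : ℝ) ^ β = k ^ (β - γ) * k ^ γ by rw [← Real.rpow_add hk']; ring_nf]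
  ring
end
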